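/- Let b ≥ 2 and α ≠ β digits. Define u₀ = b² and for m ≥ 1 the recurrence (b^{m+1} − b + b^{-m-1})·u_m = Σ_{j=1}^{m} C(m,j)·(γ_j − b^{-m-1}(αb+β)^j)·u_{m-j}, where γ_j = Σ_{d=0}^{b-1} d^j. Then u_m equals the m-th moment ∫_{[0,1)} x^m dμ(x) of the measure μ that assigns weight b^{-l} to n(X)/b^l for each length-l string X avoiding αβ; in particular (u_m) is positive and strictly decreasing with limit 0. -/

import Mathlib

open MeasureTheory

/-- The integer whose base-`b` digit string (leading digit first, possibly with
leading zeros) is `s`. -/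
def strVal (b : ℕ) (s : List (Fin b)) : ℕ := s.foldl (fun a d => a * b + d.val) 0

/-- The measure on `[0,1) ⊆ ℝ` assigning weight `b^{-l}` to `n(X)/b^l` for each
string `X` of length `l` over `Fin b` avoiding the contiguous pattern `αβ`. -/
noncomputable def mu (b : ℕ) (α β : Fin b) : Measure ℝ :=
  Measure.sum (fun s : {s : List (Fin b) // ¬ [α, β] <:+: s} =>
    ((b : ENNReal) ^ s.1.length)⁻¹ •
      Measure.dirac ((strVal b s.1 : ℝ) / (b : ℝ) ^ s.1.length))

/-- Summing over lists by splitting off the head. -/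
lemma hasSum_list_cons {b : ℕ} (h : List (Fin b) → ℝ) (c : Fin b → ℝ)
    (hc : ∀ d, HasSum (fun s => h (d :: s)) (c d)) :
    HasSum h (h [] + ∑ d, c d) := by
  classical
  have h1 : HasSum (fun s : List (Fin b) => if s = [] then h [] else 0) (h []) :=
    hasSum_ite_eq _ _
  have h2 : ∀ d ∈ (Finset.univ : Finset (Fin b)),
      HasSum (fun s : List (Fin b) => if s.head? = some d then h s else 0) (c d) := by
    intro d _
    have hinj : Function.Injective (fun s : List (Fin b) => d :: s) :=
      fun s t hst => by simpa using hst
    refine (hinj.hasSum_iff ?_).1 ?_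
    · intro s hs
      rw [if_neg]
      intro hd
      apply hs
      cases s with
      | nil => simp at hd
      | cons e t => simp at hd; exact ⟨t, by simp [hd]⟩
    · simpa [Function.comp_def] using hc d
  convert! h1.add (hasSum_sum h2) using 1
  funext s
  cases s with
  | nil => simp
  | cons e t => simp

/-- Indicator of avoiding the pattern. -/
noncomputable def avo {b : ℕ} (α β : Fin b) (s : List (Fin b)) : ℝ :=
  open Classical in if [α, β] <:+: s then 0 else 1

lemma avo_nil {b : ℕ} (α β : Fin b) : avo α β [] = 1 := by simp [avo]

lemma avo_single {b : ℕ} (α β d : Fin b) : avo α β [d] = 1 := by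
  simp [avo, List.infix_cons_iff]

lemma avo_nonneg {b : ℕ} (α β : Fin b) (s) : 0 ≤ avo α β s := by
  unfold avo; split_ifs <;> simp

lemma avo_bad {b : ℕ} (α β : Fin b) (t) : avo α β (α :: β :: t) = 0 := by
  simp [avo, List.infix_cons_iff]

lemma avo_ne {b : ℕ} (α β d : Fin b) (s) (h : d ≠ α) : avo α β (d :: s) = avo α β s := by
  simp [avo, List.infix_cons_iff, h.symm]

lemma avo_ne2 {b : ℕ} (α β d e : Fin b) (s) (h : e ≠ β) :
    avo α β (d :: e :: s) = avo α β (e :: s) := by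
  simp [avo, List.infix_cons_iff (l₂ := e :: s), h.symm]

lemma avo_hasSum {b : ℕ} (α β : Fin b) (hαβ : α ≠ β) (f : List (Fin b) → ℝ)
    (c : Fin b → ℝ) (e : ℝ)
    (hc : ∀ d, HasSum (fun s => avo α β s * f (d :: s)) (c d))
    (he : HasSum (fun t => avo α β t * f (α :: β :: t)) e) :
    HasSum (fun s => avo α β s * f s) (f [] + ∑ d, c d - e) := by
  classical
  let g : List (Fin b) → ℝ := fun s =>
    if s.head? = some β then avo α β s.tail * f (α :: s) else 0
  have hg : HasSum g e := by
    have := hasSum_list_cons g (fun d => if d = β then e else 0) (by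
      intro d
      by_cases hd : d = β
      · subst hd; simpa [g] using he
      · simp [g, hd, hasSum_zero])
    simpa [g] using this
  have := hasSum_list_cons (fun s => avo α β s * f s)
    (fun d => c d - if d = α then e else 0) (by
      intro d
      have h2 : HasSum (fun s => if d = α then g s else 0) (if d = α then e else 0) := by
        split_ifs
        · exact hg
        · exact hasSum_zero
      convert! (hc d).sub h2 using 1
      funext s
      by_cases hd : d = α
      · subst hd
        cases s with
        | nil => simp [g, avo_nil, avo_single]
        | cons e t =>
          by_cases he : e = β
          · subst he
            simp [g, avo_bad, avo_ne d e e t hαβ.symm]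
          · simp [g, he, avo_ne2]
      · simp [hd, avo_ne])
  convert! this using 1
  simp [avo_nil, Finset.sum_sub_distrib]
  ring

noncomputable def wt {b : ℕ} (s : List (Fin b)) : ℝ := ((b : ℝ) ^ s.length)⁻¹

noncomputable def pt {b : ℕ} (s : List (Fin b)) : ℝ := (strVal b s : ℝ) / (b : ℝ) ^ s.length

lemma wt_nonneg {b : ℕ} (s : List (Fin b)) : 0 ≤ wt s := by unfold wt; positivity

lemma wt_cons {b : ℕ} (d : Fin b) (s) : wt (d :: s) = wt s / b := by
  simp [wt, pow_succ, div_eq_mul_inv, mul_comm]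

lemma foldl_val {b : ℕ} (s : List (Fin b)) : ∀ a : ℕ,
    s.foldl (fun a d => a * b + d.val) a = a * b ^ s.length + strVal b s := by
  induction s with
  | nil => simp [strVal]
  | cons d s ih =>
    intro a
    simp only [strVal, List.foldl_cons, List.length_cons]
    rw [ih, ih]
    ring

lemma strVal_cons {b : ℕ} (d : Fin b) (s) :
    strVal b (d :: s) = d.val * b ^ s.length + strVal b s := by
  have := foldl_val s d.val
  simpa [strVal] using this

lemma pt_cons {b : ℕ} (hb : 2 ≤ b) (d : Fin b) (s) : pt (d :: s) = (d.val + pt s) / b := by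
  have : (b : ℝ) ≠ 0 := by positivity
  simp only [pt, strVal_cons, List.length_cons]
  push_cast
  field_simp
  ring

lemma pt_nil {b : ℕ} : pt ([] : List (Fin b)) = 0 := by simp [pt, strVal]

lemma pt_nonneg {b : ℕ} (s : List (Fin b)) : 0 ≤ pt s := by unfold pt; positivity

lemma pt_lt_one {b : ℕ} (hb : 2 ≤ b) (s : List (Fin b)) : pt s < 1 := by
  have hb0 : (0 : ℝ) < b := by positivity
  induction s with
  | nil => simp [pt_nil]
  | cons d s ih =>
    rw [pt_cons hb, div_lt_one hb0]
    have : ((d.val + 1 : ℕ) : ℝ) ≤ b := by exact_mod_cast d.2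
    push_cast at this
    linarith

noncomputable def lev (b : ℕ) : ℕ → ℝ
  | 0 => 1
  | 1 => 1
  | n + 2 => lev b (n + 1) - lev b n / (b : ℝ) ^ 2

lemma lev_hasSum {b : ℕ} (hb : 2 ≤ b) (α β : Fin b) (hαβ : α ≠ β) : ∀ n : ℕ,
    HasSum (fun s => avo α β s * (if s.length = n then wt s else 0)) (lev b n)
  | 0 => by
    have := avo_hasSum α β hαβ (fun s => if s.length = 0 then wt s else 0) (fun _ => 0) 0
      (by intro d; simp [hasSum_zero]) (by simp [hasSum_zero])
    simpa [lev, wt] using this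
  | 1 => by
    have hb0 : (b : ℝ) ≠ 0 := by positivity
    have := avo_hasSum α β hαβ (fun s => if s.length = 1 then wt s else 0) (fun _ => 1 / b) 0
      (by
        intro d
        have := (lev_hasSum hb α β hαβ 0).div_const (b : ℝ)
        convert! this using 1
        funext s
        simp [wt_cons]
        split_ifs <;> ring) (by simp [hasSum_zero])
    simpa [lev, hb0] using this
  | n + 2 => by
    have hb0 : (b : ℝ) ≠ 0 := by positivity
    have := avo_hasSum α β hαβ (fun s => if s.length = n + 2 then wt s else 0)
      (fun _ => lev b (n + 1) / b) (lev b n / (b : ℝ) ^ 2)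
      (by
        intro d
        have := (lev_hasSum hb α β hαβ (n + 1)).div_const (b : ℝ)
        convert! this using 1
        funext s
        simp [wt_cons]
        split_ifs <;> ring)
      (by
        have := (lev_hasSum hb α β hαβ n).div_const ((b : ℝ) ^ 2)
        convert! this using 1
        funext s
        simp [wt_cons]
        split_ifs
        · field_simp
        · simp)
    convert! this using 1
    simp [lev]
    field_simp

lemma lev_sum {b : ℕ} (hb : 2 ≤ b) (N : ℕ) :
    ∑ n ∈ Finset.range N, lev b n = (b : ℝ) ^ 2 * (1 - lev b (N + 1)) := by
  have hb0 : (b : ℝ) ≠ 0 := by positivity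
  induction N with
  | zero => simp [lev]
  | succ N ih =>
    rw [Finset.sum_range_succ, ih]
    simp only [lev]
    field_simp
    ring

lemma summable_wt {b : ℕ} (hb : 2 ≤ b) (α β : Fin b) (hαβ : α ≠ β) :
    Summable (fun s => avo α β s * wt s) := by
  have hterm : ∀ n s, 0 ≤ avo α β s * (if s.length = n then wt s else 0) := by
    intro n s
    refine mul_nonneg (avo_nonneg _ _ _) ?_
    split_ifs
    · exact wt_nonneg s
    · exact le_rfl
  have hl : ∀ n, 0 ≤ lev b n := fun n => (lev_hasSum hb α β hαβ n).nonneg (hterm n)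
  refine summable_of_sum_le (c := (b : ℝ) ^ 2)
    (fun s => mul_nonneg (avo_nonneg _ _ _) (wt_nonneg s)) ?_
  intro F
  obtain ⟨N, hN⟩ : ∃ N, ∀ s ∈ F, s.length < N :=
    ⟨F.sup List.length + 1, fun s hs => Nat.lt_succ_of_le (Finset.le_sup (f := List.length) hs)⟩
  calc ∑ s ∈ F, avo α β s * wt s
      = ∑ s ∈ F, ∑ n ∈ Finset.range N, avo α β s * (if s.length = n then wt s else 0) := by
        refine Finset.sum_congr rfl fun s hs => ?_
        rw [← Finset.mul_sum]
        simp [hN s hs]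
    _ = ∑ n ∈ Finset.range N, ∑ s ∈ F, avo α β s * (if s.length = n then wt s else 0) :=
        Finset.sum_comm
    _ ≤ ∑ n ∈ Finset.range N, lev b n :=
        Finset.sum_le_sum fun n _ =>
          sum_le_hasSum F (fun s _ => hterm n s) (lev_hasSum hb α β hαβ n)
    _ ≤ (b : ℝ) ^ 2 := by
        rw [lev_sum hb]
        have := mul_nonneg (sq_nonneg (b : ℝ)) (hl (N + 1))
        linarith

lemma mom_le {b : ℕ} (hb : 2 ≤ b) (α β : Fin b) (m : ℕ) (s) :
    avo α β s * (wt s * pt s ^ m) ≤ avo α β s * wt s := by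
  refine mul_le_mul_of_nonneg_left ?_ (avo_nonneg _ _ _)
  exact mul_le_of_le_one_right (wt_nonneg s) (pow_le_one₀ (pt_nonneg s) (pt_lt_one hb s).le)

lemma mom_nonneg {b : ℕ} (α β : Fin b) (m : ℕ) (s) :
    0 ≤ avo α β s * (wt s * pt s ^ m) :=
  mul_nonneg (avo_nonneg _ _ _) (mul_nonneg (wt_nonneg s) (pow_nonneg (pt_nonneg s) _))

lemma summable_mom {b : ℕ} (hb : 2 ≤ b) (α β : Fin b) (hαβ : α ≠ β) (m : ℕ) :
    Summable (fun s => avo α β s * (wt s * pt s ^ m)) :=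
  Summable.of_nonneg_of_le (mom_nonneg α β m) (mom_le hb α β m) (summable_wt hb α β hαβ)

noncomputable def mom {b : ℕ} (α β : Fin b) (m : ℕ) : ℝ :=
  ∑' s, avo α β s * (wt s * pt s ^ m)

lemma mom_shift {b : ℕ} (hb : 2 ≤ b) (α β : Fin b) (hαβ : α ≠ β) (m : ℕ) (y : ℝ) :
    HasSum (fun s => avo α β s * (wt s * (y + pt s) ^ m))
      (∑ j ∈ Finset.range (m + 1), (Nat.choose m j : ℝ) * y ^ j * mom α β (m - j)) := by
  have := hasSum_sum (s := Finset.range (m + 1)) (fun j (_ : j ∈ Finset.range (m + 1)) =>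
    (summable_mom hb α β hαβ (m - j)).hasSum.mul_left ((Nat.choose m j : ℝ) * y ^ j))
  convert! this using 1
  funext s
  rw [add_pow, Finset.mul_sum, Finset.mul_sum]
  refine Finset.sum_congr rfl fun j _ => ?_
  ring

lemma mom_eq {b : ℕ} (hb : 2 ≤ b) (α β : Fin b) (hαβ : α ≠ β) (m : ℕ) :
    mom α β m = 0 ^ m +
      ∑ d : Fin b, (∑ j ∈ Finset.range (m + 1), (Nat.choose m j : ℝ) * (d.val : ℝ) ^ j *
        mom α β (m - j)) / (b : ℝ) ^ (m + 1)
      - (∑ j ∈ Finset.range (m + 1), (Nat.choose m j : ℝ) *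
        ((α.val * b + β.val : ℕ) : ℝ) ^ j * mom α β (m - j)) / ((b : ℝ) ^ (m + 1)) ^ 2 := by
  have hb0 : (b : ℝ) ≠ 0 := by positivity
  have := avo_hasSum α β hαβ (fun s => wt s * pt s ^ m) _ _
    (fun d => by
      have := (mom_shift hb α β hαβ m (d.val : ℝ)).div_const ((b : ℝ) ^ (m + 1))
      convert! this using 1
      funext s
      rw [wt_cons, pt_cons hb, div_pow]
      field_simp
      ring)
    (by
      have := (mom_shift hb α β hαβ m ((α.val * b + β.val : ℕ) : ℝ)).div_const
        (((b : ℝ) ^ (m + 1)) ^ 2)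
      convert! this using 1
      funext s
      rw [wt_cons, wt_cons, pt_cons hb, pt_cons hb]
      have : ((α.val : ℝ) + ((β.val : ℝ) + pt s) / b) / b =
          (((α.val * b + β.val : ℕ) : ℝ) + pt s) / b ^ 2 := by
        push_cast
        field_simp
        ring
      rw [this, div_pow]
      field_simp
      ring)
  have h2 := (summable_mom hb α β hαβ m).hasSum.unique this
  rw [mom, h2]
  simp [wt, pt_nil]

lemma mom_zero {b : ℕ} (hb : 2 ≤ b) (α β : Fin b) (hαβ : α ≠ β) :
    mom α β 0 = (b : ℝ) ^ 2 := by
  have hb0 : (b : ℝ) ≠ 0 := by positivity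
  have := mom_eq hb α β hαβ 0
  simp at this
  field_simp at this
  linarith

lemma mom_rec {b : ℕ} (hb : 2 ≤ b) (α β : Fin b) (hαβ : α ≠ β) (m : ℕ) (hm : 1 ≤ m) :
    ((b : ℝ) ^ (m + 1) - b + ((b : ℝ) ^ (m + 1))⁻¹) * mom α β m =
        ∑ j ∈ Finset.Icc 1 m, (Nat.choose m j : ℝ) *
          ((∑ d ∈ Finset.range b, (d : ℝ) ^ j) -
            ((b : ℝ) ^ (m + 1))⁻¹ * ((α.val * b + β.val : ℕ) : ℝ) ^ j) * mom α β (m - j) := by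
  have hb0 : (b : ℝ) ≠ 0 := by positivity
  have key := mom_eq hb α β hαβ m
  have split : ∀ f : ℕ → ℝ, ∑ j ∈ Finset.range (m + 1), f j =
      f 0 + ∑ j ∈ Finset.Icc 1 m, f j := by
    intro f
    rw [Finset.range_eq_Ico, Finset.sum_eq_sum_Ico_succ_bot (by omega)]
    rfl
  generalize hP : (b : ℝ) ^ (m + 1) = P at *
  have hP0 : P ≠ 0 := by rw [← hP]; positivity
  generalize ((α.val * b + β.val : ℕ) : ℝ) = A at *
  rw [← Finset.sum_div, Finset.sum_comm, split, split] at key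
  have e1 : ∀ j, ∑ d : Fin b, (Nat.choose m j : ℝ) * (d.val : ℝ) ^ j * mom α β (m - j) =
      (Nat.choose m j : ℝ) * (∑ d ∈ Finset.range b, (d : ℝ) ^ j) * mom α β (m - j) := by
    intro j
    rw [← Finset.sum_mul, ← Finset.mul_sum, Finset.sum_range]
  simp only [e1] at key
  have e2 : ∑ j ∈ Finset.Icc 1 m, (Nat.choose m j : ℝ) *
          ((∑ d ∈ Finset.range b, (d : ℝ) ^ j) - P⁻¹ * A ^ j) * mom α β (m - j) =
      ∑ j ∈ Finset.Icc 1 m, (Nat.choose m j : ℝ) *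
          (∑ d ∈ Finset.range b, (d : ℝ) ^ j) * mom α β (m - j) -
      P⁻¹ * ∑ j ∈ Finset.Icc 1 m, (Nat.choose m j : ℝ) * A ^ j * mom α β (m - j) := by
    rw [Finset.mul_sum, ← Finset.sum_sub_distrib]
    refine Finset.sum_congr rfl fun j _ => ?_
    ring
  rw [e2]
  generalize ∑ j ∈ Finset.Icc 1 m, (Nat.choose m j : ℝ) *
          (∑ d ∈ Finset.range b, (d : ℝ) ^ j) * mom α β (m - j) = S1 at *
  generalize ∑ j ∈ Finset.Icc 1 m, (Nat.choose m j : ℝ) * A ^ j * mom α β (m - j) = S2 at *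
  rw [zero_pow (by omega)] at key
  simp at key
  generalize mom α β m = M at *
  field_simp at key ⊢
  linarith

lemma mom_integral {b : ℕ} (hb : 2 ≤ b) (α β : Fin b) (m : ℕ) :
    ∫ x, x ^ m ∂(mu b α β) = mom α β m := by
  have hbe : (b : ENNReal) ≠ 0 := by
    simp; omega
  rw [mu, integral_sum_dirac (fun i => by simp [hbe])]
  rw [mom]
  have h1 : (fun s => avo α β s * (wt s * pt s ^ m)) =
      Set.indicator {s : List (Fin b) | ¬ [α, β] <:+: s} (fun s => wt s * pt s ^ m) := by
    funext s
    by_cases h : [α, β] <:+: s <;> simp [avo, Set.indicator, h]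
  rw [h1, ← tsum_subtype]
  refine tsum_congr fun s => ?_
  simp [wt, pt]

lemma mom_strict {b : ℕ} (hb : 2 ≤ b) (α β : Fin b) (hαβ : α ≠ β) :
    StrictAnti (fun m => mom α β m) := by
  refine strictAnti_nat_of_succ_lt fun m => ?_
  have hb0 : (0 : ℝ) < b := by positivity
  refine Summable.tsum_lt_tsum (i := [⟨1, by omega⟩]) (fun s => ?_) ?_
    (summable_mom hb α β hαβ _) (summable_mom hb α β hαβ _)
  · refine mul_le_mul_of_nonneg_left ?_ (avo_nonneg _ _ _)
    refine mul_le_mul_of_nonneg_left ?_ (wt_nonneg s)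
    exact pow_le_pow_of_le_one (pt_nonneg s) (pt_lt_one hb s).le (Nat.le_succ m)
  · have hp : 0 < pt [(⟨1, by omega⟩ : Fin b)] := by
      rw [pt_cons hb, pt_nil]; simp; omega
    have hw : 0 < wt [(⟨1, by omega⟩ : Fin b)] := by
      simp only [wt]; positivity
    rw [avo_single, one_mul, one_mul]
    exact mul_lt_mul_of_pos_left
      (pow_lt_pow_right_of_lt_one₀ hp (pt_lt_one hb _) (Nat.lt_succ_self m)) hw

lemma mom_tendsto {b : ℕ} (hb : 2 ≤ b) (α β : Fin b) (hαβ : α ≠ β) :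
    Filter.Tendsto (fun m => mom α β m) Filter.atTop (nhds 0) := by
  have := tendsto_tsum_of_dominated_convergence (𝓕 := Filter.atTop)
    (f := fun (m : ℕ) s => avo α β s * (wt s * pt s ^ m)) (g := fun _ => 0)
    (summable_wt hb α β hαβ)
    (fun s => by
      have := ((tendsto_pow_atTop_nhds_zero_of_lt_one (pt_nonneg s)
        (pt_lt_one hb s)).const_mul (wt s)).const_mul (avo α β s)
      simpa using this)
    (Filter.Eventually.of_forall fun m s => by
      rw [Real.norm_of_nonneg (mom_nonneg α β m s)]
      exact mom_le hb α β m s)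
  simpa [mom] using this

theorem stmt_8 (b : ℕ) (hb : 2 ≤ b) (α β : Fin b) (hαβ : α ≠ β) (u : ℕ → ℝ)
    (h0 : u 0 = (b : ℝ) ^ 2)
    (hrec : ∀ m : ℕ, 1 ≤ m →
      ((b : ℝ) ^ (m + 1) - b + ((b : ℝ) ^ (m + 1))⁻¹) * u m =
        ∑ j ∈ Finset.Icc 1 m, (Nat.choose m j : ℝ) *
          ((∑ d ∈ Finset.range b, (d : ℝ) ^ j) -
            ((b : ℝ) ^ (m + 1))⁻¹ * ((α.val * b + β.val : ℕ) : ℝ) ^ j) * u (m - j)) :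
    (∀ m : ℕ, u m = ∫ x, x ^ m ∂(mu b α β)) ∧
    (∀ m : ℕ, 0 < u m) ∧ StrictAnti u ∧
    Filter.Tendsto u Filter.atTop (nhds 0) := by
  have hu : ∀ m, u m = mom α β m := by
    intro m
    induction m using Nat.strong_induction_on with
    | _ m ih =>
      rcases Nat.eq_zero_or_pos m with rfl | hm
      · rw [h0, mom_zero hb α β hαβ]
      · have h1 := hrec m hm
        have h2 := mom_rec hb α β hαβ m hm
        have h3 : ((b : ℝ) ^ (m + 1) - b + ((b : ℝ) ^ (m + 1))⁻¹) * u m =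
            ((b : ℝ) ^ (m + 1) - b + ((b : ℝ) ^ (m + 1))⁻¹) * mom α β m := by
          rw [h1, h2]
          refine Finset.sum_congr rfl fun j hj => ?_
          rw [Finset.mem_Icc] at hj
          rw [ih (m - j) (by omega)]
        have hb1 : (1 : ℝ) ≤ b := by exact_mod_cast (by omega : 1 ≤ b)
        have hle : (b : ℝ) ≤ (b : ℝ) ^ (m + 1) := le_self_pow₀ hb1 (by omega)
        have hpos : (0 : ℝ) < ((b : ℝ) ^ (m + 1))⁻¹ := by positivity
        exact mul_left_cancel₀ (by linarith : _ < _).ne' h3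
  have hfun : u = fun m => mom α β m := funext hu
  have hanti : StrictAnti u := hfun ▸ mom_strict hb α β hαβ
  refine ⟨fun m => by rw [hu, mom_integral hb], fun m => ?_, hanti,
    hfun ▸ mom_tendsto hb α β hαβ⟩
  have h1 : 0 ≤ u (m + 1) := by
    rw [hu]; exact tsum_nonneg (mom_nonneg α β _)
  exact h1.trans_lt (hanti (Nat.lt_succ_self m))
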